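/- arXiv:2205.06718 — 3 statements merged into one kernel-verified Lean document; each statement's English description precedes it below -/
import Mathlib

section
/- Let u : ℝ³ → ℝ³ be twice continuously differentiable with compact support. Denote by ∂_i u_j the partial derivative of the j-th component in the i-th coordinate direction, by ε(u)_{ij} = (∂_i u_j + ∂_j u_i)/2 the strain tensor, and by div u = ∑_i ∂_i u_i the divergence. Then the Korn identity holds: 2 ∫_{ℝ³} ∑_{i,j} ε(u)_{ij}² dx = ∫_{ℝ³} ∑_{i,j} (∂_i u_j)² dx + ∫_{ℝ³} (div u)² dx; in particular Korn's first inequality ∫_{ℝ³} ∑_{i,j} (∂_i u_j)² dx ≤ 2 ∫_{ℝ³} ∑_{i,j} ε(u)_{ij}² dx holds. -/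
open Finset MeasureTheory

section

variable {E : Type*} [NormedAddCommGroup E] [NormedSpace ℝ E]

/-- Directional derivatives of a `C²` function commute. -/
theorem fderiv_fderiv_apply_comm {f : E → ℝ} (hf : ContDiff ℝ 2 f) (v w x : E) :
    fderiv ℝ (fun y => fderiv ℝ f y v) x w = fderiv ℝ (fun y => fderiv ℝ f y w) x v := by
  have hd : DifferentiableAt ℝ (fderiv ℝ f) x :=
    (hf.fderiv_right (m := 1) (by norm_num)).differentiable (by norm_num) x
  have h : ∀ a b : E, fderiv ℝ (fun y => fderiv ℝ f y a) x b =
      fderiv ℝ (fderiv ℝ f) x b a := fun a b => by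
    rw [fderiv_clm_apply hd (differentiableAt_const a)]
    simp
  rw [h, h]
  exact (hf.contDiffAt.isSymmSndFDerivAt (by simp)).eq w v

variable [FiniteDimensional ℝ E] [MeasurableSpace E] [BorelSpace E]

/-- Two directions can be exchanged in the integral of a product of directional derivatives
when both functions are `C²` and one of them has compact support. -/
theorem integral_fderiv_mul_fderiv_swap (μ : Measure E) [μ.IsAddHaarMeasure] {f g : E → ℝ}
    (hf : ContDiff ℝ 2 f) (hg : ContDiff ℝ 2 g) (hs : HasCompactSupport g) (v w : E) :
    ∫ x, fderiv ℝ f x v * fderiv ℝ g x w ∂μ = ∫ x, fderiv ℝ f x w * fderiv ℝ g x v ∂μ := by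
  have hf1 : ∀ a : E, ContDiff ℝ 1 (fun x => fderiv ℝ f x a) := fun a =>
    (hf.fderiv_right (m := 1) (by norm_num)).clm_apply contDiff_const
  have hg1 : ∀ a : E, Continuous (fun x => fderiv ℝ g x a) := fun a =>
    (hg.continuous_fderiv (by norm_num)).clm_apply continuous_const
  have hf2 : ∀ a b : E, Continuous (fun x => fderiv ℝ (fun y => fderiv ℝ f y a) x b) :=
    fun a b => ((hf1 a).continuous_fderiv (by norm_num)).clm_apply continuous_const
  have key : ∀ a b : E, ∫ x, fderiv ℝ f x a * fderiv ℝ g x b ∂μ =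
      -∫ x, fderiv ℝ (fun y => fderiv ℝ f y a) x b * g x ∂μ := fun a b =>
    integral_mul_fderiv_eq_neg_fderiv_mul_of_integrable
      (((hf2 a b).mul hg.continuous).integrable_of_hasCompactSupport hs.mul_left)
      (((hf1 a).continuous.mul (hg1 b)).integrable_of_hasCompactSupport
        (hs.fderiv_apply ℝ b).mul_left)
      (((hf1 a).continuous.mul hg.continuous).integrable_of_hasCompactSupport hs.mul_left)
      (fun x _ => (hf1 a).differentiable (by norm_num) x)
      (fun x _ => hg.differentiable (by norm_num) x)
  rw [key, key]
  simp_rw [fderiv_fderiv_apply_comm hf v w]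

end

/-- Korn identity and Korn's first inequality for smooth compactly supported vector
fields on ℝ³: writing `∂ᵢuⱼ x = fderiv ℝ u x (eᵢ) j`, the strain tensor
`ε(u)ᵢⱼ = (∂ᵢuⱼ + ∂ⱼuᵢ)/2` and the divergence `div u = ∑ᵢ ∂ᵢuᵢ` satisfy
`2∫ ∑ ε(u)ᵢⱼ² = ∫ ∑ (∂ᵢuⱼ)² + ∫ (div u)²`, hence
`∫ ∑ (∂ᵢuⱼ)² ≤ 2∫ ∑ ε(u)ᵢⱼ²`. -/
theorem korn_identity_and_inequality
    (u : EuclideanSpace ℝ (Fin 3) → EuclideanSpace ℝ (Fin 3))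
    (hu : ContDiff ℝ 2 u) (hsupp : HasCompactSupport u) :
    (2 * ∫ x, ∑ i, ∑ j,
        ((fderiv ℝ u x (EuclideanSpace.single i 1) j +
          fderiv ℝ u x (EuclideanSpace.single j 1) i) / 2) ^ 2 =
      (∫ x, ∑ i, ∑ j, (fderiv ℝ u x (EuclideanSpace.single i 1) j) ^ 2) +
        ∫ x, (∑ i, fderiv ℝ u x (EuclideanSpace.single i 1) i) ^ 2) ∧
    (∫ x, ∑ i, ∑ j, (fderiv ℝ u x (EuclideanSpace.single i 1) j) ^ 2) ≤
      2 * ∫ x, ∑ i, ∑ j,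
        ((fderiv ℝ u x (EuclideanSpace.single i 1) j +
          fderiv ℝ u x (EuclideanSpace.single j 1) i) / 2) ^ 2 := by
  set D : Fin 3 → Fin 3 → EuclideanSpace ℝ (Fin 3) → ℝ :=
    fun i j x => fderiv ℝ u x (EuclideanSpace.single i 1) j
  have hcomp : ∀ j, ContDiff ℝ 2 (fun x => u x j) := fun j => by fun_prop
  have hcs : ∀ j, HasCompactSupport (fun x => u x j) := fun j =>
    hsupp.comp_left (g := fun y : EuclideanSpace ℝ (Fin 3) => y j) rfl
  have hDf : ∀ i j x, D i j x =
      fderiv ℝ (fun y => u y j) x (EuclideanSpace.single i 1) := fun i j x => by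
    have h := ((EuclideanSpace.proj (𝕜 := ℝ) j).hasFDerivAt.comp x
      (hu.differentiable (by norm_num) x).hasFDerivAt).fderiv
    exact (DFunLike.congr_fun h (EuclideanSpace.single i 1)).symm
  have hDc : ∀ i j, Continuous (D i j) := fun i j => by
    rw [funext (hDf i j)]
    exact ((hcomp j).continuous_fderiv (by norm_num)).clm_apply continuous_const
  have hDs : ∀ i j, HasCompactSupport (D i j) := fun i j => by
    rw [funext (hDf i j)]
    exact (hcs j).fderiv_apply ℝ _
  have hint : ∀ i j k l, Integrable (fun x => D i j x * D k l x) := fun i j k l =>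
    ((hDc i j).mul (hDc k l)).integrable_of_hasCompactSupport (hDs k l).mul_left
  have hswap : ∀ i j, ∫ x, D i j x * D j i x = ∫ x, D i i x * D j j x := fun i j => by
    simp_rw [hDf]
    rw [integral_fderiv_mul_fderiv_swap volume (hcomp j) (hcomp i) (hcs i)]
    simp_rw [mul_comm]
  have hgrad : Integrable (fun x => ∑ i, ∑ j, D i j x ^ 2) := by
    simp_rw [sq]
    exact integrable_finsetSum _ fun i _ => integrable_finsetSum _ fun j _ => hint i j i j
  have hcross : Integrable (fun x => ∑ i, ∑ j, D i j x * D j i x) :=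
    integrable_finsetSum _ fun i _ => integrable_finsetSum _ fun j _ => hint i j j i
  have hdiv : ∫ x, ∑ i, ∑ j, D i j x * D j i x = ∫ x, (∑ i, D i i x) ^ 2 := by
    simp_rw [sq, sum_mul_sum]
    rw [integral_finsetSum _ fun i _ => integrable_finsetSum _ fun j _ => hint i j j i,
      integral_finsetSum _ fun i _ => integrable_finsetSum _ fun j _ => hint i i j j]
    refine sum_congr rfl fun i _ => ?_
    rw [integral_finsetSum _ fun j _ => hint i j j i,
      integral_finsetSum _ fun j _ => hint i i j j]
    exact sum_congr rfl fun j _ => hswap i j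
  have hkorn : 2 * ∫ x, ∑ i, ∑ j, ((D i j x + D j i x) / 2) ^ 2 =
      (∫ x, ∑ i, ∑ j, D i j x ^ 2) + ∫ x, (∑ i, D i i x) ^ 2 := by
    rw [← hdiv, ← integral_add hgrad hcross, ← integral_const_mul]
    refine integral_congr_ae (.of_forall fun x => ?_)
    simp only [Fin.sum_univ_three]
    ring
  refine ⟨hkorn, ?_⟩
  have hnonneg : 0 ≤ ∫ x, (∑ i, D i i x) ^ 2 := integral_nonneg fun x => sq_nonneg _
  exact hkorn ▸ le_add_of_nonneg_right hnonneg
end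

section
/- (Comparison of third-order impedance symbols with Bendali–Lemrabet.) Let α > 0 and h ∈ ℝ. For ε ≠ 0 with 1 + εh ≠ 0, set N(ε) = α·ε⁻¹·(1 + εh) (the acoustic impedance symbol of order 3) and b(ε) = (ε/α)·(1 − εh) (minus the elasto-acoustic impedance symbol −B_{2,ε} of order 3, with α⁻¹ = ρ_f ω²). Then for all such ε, 1/N(ε) − b(ε) = ε³·h²/(α·(1+εh)); in particular the function ε ↦ 1/N(ε) − b(ε) is O(ε³) as ε → 0. Moreover for h = 0 (the order-2 case N(ε) = α/ε, b(ε) = ε/α) the relation is exact: 1/N(ε) = b(ε) for all ε ≠ 0. -/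
open Asymptotics

/-- The difference of the two impedance symbols in closed form; at `ε = 0` both sides vanish. -/
theorem inv_impedance_sub_eq {K : Type*} [Field K] {α h ε : K} (hα : α ≠ 0)
    (hε : 1 + ε * h ≠ 0) :
    1 / (α * ε⁻¹ * (1 + ε * h)) - (ε / α) * (1 - ε * h) =
      ε ^ 3 * h ^ 2 / (α * (1 + ε * h)) := by
  rcases eq_or_ne ε 0 with rfl | h0
  · simp
  · field_simp
    ring

/-- Comparison of the third-order impedance symbols: with
`N ε = α ε⁻¹ (1 + εh)` (acoustic symbol of Bendali–Lemrabet) and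
`b ε = (ε/α)(1 - εh)` (minus the elasto-acoustic symbol `-B₂,ε`), one has
`1/N ε - b ε = ε³h²/(α(1+εh))` whenever `ε ≠ 0` and `1 + εh ≠ 0`;
hence `ε ↦ 1/N ε - b ε` is `O(ε³)` as `ε → 0`. Moreover, for `h = 0` the relation
is exact: `1/N ε = b ε` for all `ε ≠ 0`. -/
theorem impedance_symbol_comparison_order_three (α h : ℝ) (hα : 0 < α) :
    (∀ ε : ℝ, ε ≠ 0 → 1 + ε * h ≠ 0 →
      1 / (α * ε⁻¹ * (1 + ε * h)) - (ε / α) * (1 - ε * h) =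
        ε ^ 3 * h ^ 2 / (α * (1 + ε * h))) ∧
    (fun ε : ℝ => 1 / (α * ε⁻¹ * (1 + ε * h)) - (ε / α) * (1 - ε * h))
      =O[nhds 0] (fun ε : ℝ => ε ^ 3) ∧
    (h = 0 → ∀ ε : ℝ, ε ≠ 0 →
      1 / (α * ε⁻¹ * (1 + ε * h)) = (ε / α) * (1 - ε * h)) := by
  refine ⟨fun ε _ hε => inv_impedance_sub_eq hα.ne' hε, ?_, ?_⟩
  · have hne : ∀ᶠ ε : ℝ in nhds 0, 1 + ε * h ≠ 0 :=
      ContinuousAt.eventually_ne (by fun_prop) (by simp)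
    have hcont : ContinuousAt (fun ε : ℝ => h ^ 2 / (α * (1 + ε * h))) 0 :=
      ContinuousAt.div (by fun_prop) (by fun_prop) (by simpa using hα.ne')
    have hO := (isBigO_refl (fun ε : ℝ => ε ^ 3) (nhds 0)).mul (hcont.tendsto.isBigO_one ℝ)
    refine hO.congr' ?_ (by simp)
    filter_upwards [hne] with ε hε
    rw [inv_impedance_sub_eq hα.ne' hε, mul_div_assoc]
  · rintro rfl ε -
    simp [div_eq_mul_inv, mul_comm]
end

section
/- (Comparison of fourth-order impedance symbols with Bendali–Lemrabet.) Let α > 0 and h, m ∈ ℝ. For ε near 0 with 1 + εh + ε²m ≠ 0, set N(ε) = α·ε⁻¹·(1 + εh + ε²m) (the acoustic impedance symbol of order 4) and b(ε) = (ε/α)·(1 − εh + ε²(h² − m)) (minus the elasto-acoustic impedance symbol −B_{3,ε} of order 4, with α⁻¹ = ρ_f ω²). Then the function ε ↦ 1/N(ε) − b(ε) is O(ε⁴) as ε → 0. -/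
open Asymptotics

/-- Comparison of the fourth-order impedance symbols: with
`N ε = α ε⁻¹ (1 + εh + ε²m)` (acoustic symbol of Bendali–Lemrabet) and
`b ε = (ε/α)(1 - εh + ε²(h² - m))` (minus the elasto-acoustic symbol `-B₃,ε`),
the function `ε ↦ 1/N ε - b ε` is `O(ε⁴)` as `ε → 0`. -/
theorem impedance_symbol_comparison_order_four (α h m : ℝ) (hα : 0 < α) :
    (fun ε : ℝ =>
        1 / (α * ε⁻¹ * (1 + ε * h + ε ^ 2 * m)) -
          (ε / α) * (1 - ε * h + ε ^ 2 * (h ^ 2 - m)))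
      =O[nhds 0] (fun ε : ℝ => ε ^ 4) := by
  have hD : ContinuousAt (fun ε : ℝ => 1 + ε * h + ε ^ 2 * m) 0 := by fun_prop
  have hD_ne : ∀ᶠ ε : ℝ in nhds 0, 1 + ε * h + ε ^ 2 * m ≠ 0 := hD.eventually_ne (by simp)
  have hg : ContinuousAt (fun ε : ℝ =>
      (2 * h * m - h ^ 3 - ε * (m * (h ^ 2 - m))) / (α * (1 + ε * h + ε ^ 2 * m))) 0 :=
    ContinuousAt.div (by fun_prop) (by fun_prop) (by simp [hα.ne'])
  have h_bound := (isBigO_refl (fun ε : ℝ => ε ^ 4) (nhds 0)).mul (hg.tendsto.isBigO_one ℝ)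
  simp only [mul_one] at h_bound
  refine h_bound.congr' ?_ Filter.EventuallyEq.rfl
  filter_upwards [hD_ne] with ε hε
  rcases eq_or_ne ε 0 with rfl | hε0
  · simp
  · have hα0 := hα.ne'
    field_simp
    ring
end
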